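/- arXiv:2603.05098 — 3 statements merged into one kernel-verified Lean document; each statement's English description precedes it below -/
import Mathlib

section
/- Assume α ∈ ℓ^{1,2}(ℤ) and suppose Σ_{j∈ℤ} α_j m_+(0, j) = 0. Then the limit b₀ := lim_{λ→0, λ∈ℝ∖{0}} b(λ) exists in ℂ and |b₀| ≥ 1. Consequently, the function b is continuous on ℝ∖{0}, and λ ↦ 1/b(λ) extends to a continuous nowhere-vanishing function on ℝ. -/
open Complex Filter Topology

/-- The summand of the series defining `m_+(λ,x)`, indexed by an increasing tuple
`j : Fin (n+1) → ℤ` (with the convention `j₀ = x`):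
`∏_{l} α_{j_l} (e^{2iλ(j_l − j_{l−1})} − 1)/(2iλ)`. -/
noncomputable def jostTermP (α : ℤ → ℝ) (lam : ℂ) (x : ℝ) {n : ℕ} (j : Fin (n + 1) → ℤ) : ℂ :=
  ∏ l : Fin (n + 1),
    (α (j l) : ℂ) *
      ((Complex.exp (2 * Complex.I * lam *
          ((j l : ℂ) - (Fin.cons (x : ℂ) (fun k : Fin n => ((j k.castSucc : ℤ) : ℂ)) : Fin (n + 1) → ℂ) l)) - 1) /
        (2 * Complex.I * lam))

/-- The index set for `m_+(λ,x)`: strictly increasing integer tuples above `x`. -/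
def jostIdxP (x : ℝ) (n : ℕ) : Type :=
  {j : Fin (n + 1) → ℤ // StrictMono j ∧ x < ((j 0 : ℤ) : ℝ)}

/-- `m_+(λ, x) = 1 + Σ_{n≥1} Σ_{x<j₁<⋯<j_n} ∏_l α_{j_l} (e^{2iλ(j_l−j_{l−1})}−1)/(2iλ)`. -/
noncomputable def mPlus (α : ℤ → ℝ) (lam : ℂ) (x : ℝ) : ℂ :=
  1 + ∑' (n : ℕ) (j : jostIdxP x n), jostTermP α lam x j.1

/-- The summand of the series defining the zero-energy function `m_+(0,x)`:
`∏_l α_{j_l} (j_l − j_{l−1})` with `j₀ = x`. -/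
noncomputable def jostTermP0 (α : ℤ → ℝ) (x : ℝ) {n : ℕ} (j : Fin (n + 1) → ℤ) : ℂ :=
  ∏ l : Fin (n + 1),
    (α (j l) : ℂ) *
      ((j l : ℂ) - (Fin.cons (x : ℂ) (fun k : Fin n => ((j k.castSucc : ℤ) : ℂ)) : Fin (n + 1) → ℂ) l)

/-- `m_+(0, x) = 1 + Σ_{n≥1} Σ_{x<j₁<⋯<j_n} ∏_l α_{j_l} (j_l − j_{l−1})`. -/
noncomputable def mPlusZero (α : ℤ → ℝ) (x : ℝ) : ℂ :=
  1 + ∑' (n : ℕ) (j : jostIdxP x n), jostTermP0 α x j.1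

/-- `b(λ) = 1 − (1/(2iλ)) Σ_{j∈ℤ} α_j m_+(λ, j)` for real `λ ≠ 0`. -/
noncomputable def bCoef (α : ℤ → ℝ) (lam : ℝ) : ℂ :=
  1 - (1 / (2 * Complex.I * (lam : ℂ))) * ∑' j : ℤ, (α j : ℂ) * mPlus α (lam : ℂ) (j : ℝ)

/-- The kernel `(e^{2iλy} − 1)/(2iλ)`, extended by its limit `y` at `λ = 0`. -/
noncomputable def jostKernel (lam : ℝ) (y : ℤ) : ℂ :=
  if lam = 0 then (y : ℂ) else
    (Complex.exp (2 * Complex.I * lam * y) - 1) / (2 * Complex.I * lam)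

/-- The gap `j_l − j_{l−1}` of an integer tuple, with `j₀ = x`. -/
def gap (x : ℤ) {n : ℕ} (t : Fin (n + 1) → ℤ) (l : Fin (n + 1)) : ℤ :=
  t l - (Fin.cons x (fun k : Fin n => t k.castSucc) : Fin (n + 1) → ℤ) l

/-- The summand of the Jost series at an integer base point, uniformly in real `λ`. -/
noncomputable def jostTerm (α : ℤ → ℝ) (lam : ℝ) (x : ℤ) {n : ℕ} (t : Fin (n + 1) → ℤ) : ℂ :=
  ∏ l, (α (t l) : ℂ) * jostKernel lam (gap x t l)

/-- The joint index set of the Jost series at the base point `x`. -/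
abbrev JostIdx (x : ℤ) : Type := Σ n : ℕ, jostIdxP (x : ℝ) n

/-- The Jost solution at an integer point as a single series. -/
noncomputable def jostSum (α : ℤ → ℝ) (lam : ℝ) (x : ℤ) : ℂ :=
  1 + ∑' p : JostIdx x, jostTerm α lam x p.2.1

/-- The summable weight dominating all the series. -/
noncomputable def jostWeight (α : ℤ → ℝ) (j : ℤ) : ℝ := 2 * (1 + |(j : ℝ)|) ^ 2 * |α j|

lemma cast_cons_castSucc (x : ℤ) {n : ℕ} (t : Fin (n + 1) → ℤ) (l : Fin (n + 1)) :
    (Fin.cons ((x : ℝ) : ℂ) (fun k : Fin n => ((t k.castSucc : ℤ) : ℂ)) : Fin (n + 1) → ℂ) l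
      = ((Fin.cons x (fun k : Fin n => t k.castSucc) : Fin (n + 1) → ℤ) l : ℂ) := by
  refine Fin.cases ?_ (fun k => ?_) l <;> simp

lemma jostTermP_eq (α : ℤ → ℝ) {lam : ℝ} (h : lam ≠ 0) (x : ℤ) {n : ℕ} (t : Fin (n + 1) → ℤ) :
    jostTermP α (lam : ℂ) (x : ℝ) t = jostTerm α lam x t := by
  unfold jostTermP jostTerm jostKernel gap
  refine Finset.prod_congr rfl fun l _ => ?_
  rw [cast_cons_castSucc, if_neg h]
  push_cast
  rfl

lemma jostTermP0_eq (α : ℤ → ℝ) (x : ℤ) {n : ℕ} (t : Fin (n + 1) → ℤ) :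
    jostTermP0 α (x : ℝ) t = jostTerm α 0 x t := by
  unfold jostTermP0 jostTerm jostKernel gap
  refine Finset.prod_congr rfl fun l _ => ?_
  rw [cast_cons_castSucc, if_pos rfl]
  push_cast
  rfl

lemma gap_eq (x : ℤ) {n : ℕ} (t : Fin (n + 1) → ℤ) (l : Fin (n + 1)) :
    gap x t l = (Fin.cons x t : Fin (n + 2) → ℤ) l.succ
      - (Fin.cons x t : Fin (n + 2) → ℤ) l.castSucc := by
  unfold gap
  refine Fin.cases ?_ (fun k => ?_) l
  · simp
  · rw [← Fin.succ_castSucc]; simp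

lemma strictMono_cons {x : ℤ} {n : ℕ} (t : jostIdxP (x : ℝ) n) :
    StrictMono (Fin.cons x t.1 : Fin (n + 2) → ℤ) := by
  have h0 : x < t.1 0 := by exact_mod_cast t.2.2
  rw [Fin.strictMono_iff_lt_succ]
  intro i
  refine Fin.cases ?_ (fun k => ?_) i
  · simpa using h0
  · rw [← Fin.succ_castSucc]
    simpa using t.2.1 (Fin.castSucc_lt_succ (i := k))

lemma one_le_gap {x : ℤ} {n : ℕ} (t : jostIdxP (x : ℝ) n) (l : Fin (n + 1)) :
    1 ≤ gap x t.1 l := by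
  have := strictMono_cons t (Fin.castSucc_lt_succ (i := l))
  rw [gap_eq]; omega

lemma norm_jostKernel_le (lam : ℝ) (y : ℤ) : ‖jostKernel lam y‖ ≤ |(y : ℝ)| := by
  unfold jostKernel
  split_ifs with h
  · simp
  · have h1 := Real.norm_exp_I_mul_ofReal_sub_one_le (x := 2 * lam * y)
    have h2 : (2 * Complex.I * lam * y : ℂ) = Complex.I * ((2 * lam * y : ℝ) : ℂ) := by
      push_cast; ring
    rw [h2, norm_div, div_le_iff₀ (by simpa using h)]
    refine h1.trans (le_of_eq ?_)
    simp; ring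

lemma norm_exp_I_mul_sub_le (θ : ℝ) :
    ‖Complex.exp (Complex.I * θ) - 1 - Complex.I * θ‖ ≤ 2 * θ ^ 2 := by
  by_cases h : |θ| ≤ 1
  · have := Complex.norm_exp_sub_one_sub_id_le (x := Complex.I * θ) (by simpa using h)
    simp at this
    nlinarith [sq_nonneg θ]
  · push Not at h
    have h1 := Real.norm_exp_I_mul_ofReal_sub_one_le (x := θ)
    have h2 := norm_sub_le (Complex.exp (Complex.I * θ) - 1) (Complex.I * θ)
    have h3 : ‖Complex.I * (θ : ℂ)‖ = |θ| := by simp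
    rw [Real.norm_eq_abs] at h1
    nlinarith [sq_abs θ]

lemma norm_jostKernel_sub_le (lam : ℝ) (y : ℤ) :
    ‖jostKernel lam y - jostKernel 0 y‖ ≤ 4 * |lam| * (y : ℝ) ^ 2 := by
  by_cases h : lam = 0
  · simp [h]
  have h1 := norm_exp_I_mul_sub_le (2 * lam * y)
  have hc : (lam : ℂ) ≠ 0 := by exact_mod_cast h
  have h2 : jostKernel lam y - jostKernel 0 y
      = (Complex.exp (Complex.I * ((2 * lam * y : ℝ) : ℂ)) - 1
          - Complex.I * ((2 * lam * y : ℝ) : ℂ)) / (2 * Complex.I * lam) := by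
    unfold jostKernel
    rw [if_neg h, if_pos rfl]
    have : (2 * Complex.I * lam * y : ℂ) = Complex.I * ((2 * lam * y : ℝ) : ℂ) := by
      push_cast; ring
    rw [this]
    field_simp
    push_cast
    ring
  rw [h2, norm_div, div_le_iff₀ (by simpa using h)]
  refine h1.trans (le_of_eq ?_)
  simp
  have : lam ^ 2 = |lam| * |lam| := by rw [← sq, sq_abs]
  linear_combination 8 * (y:ℝ)^2 * this

lemma differentiable_jostKernel (y : ℤ) : Differentiable ℝ (fun lam : ℝ => jostKernel lam y) := by
  set E : ℂ → ℂ := fun z => Complex.exp (2 * Complex.I * z * y) / (2 * Complex.I) with hE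
  have hd : Differentiable ℂ E := by fun_prop
  have hs : Differentiable ℂ (dslope E 0) := by
    rw [← differentiableOn_univ, Complex.differentiableOn_dslope univ_mem]
    exact hd.differentiableOn
  have h0 : HasDerivAt E (y : ℂ) 0 := by
    have h1 : HasDerivAt (fun z : ℂ => 2 * Complex.I * z * y) (2 * Complex.I * y) 0 := by
      simpa using ((hasDerivAt_id (0 : ℂ)).const_mul (2 * Complex.I)).mul_const (y : ℂ)
    have h2 : HasDerivAt E _ 0 := h1.cexp.div_const (2 * Complex.I)
    refine h2.congr_deriv ?_
    simp
  have heq : (fun lam : ℝ => jostKernel lam y) = fun lam : ℝ => dslope E 0 (lam : ℂ) := by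
    funext lam
    by_cases h : lam = 0
    · subst h
      simp [jostKernel, dslope_same, h0.deriv]
    · have hc : (lam : ℂ) ≠ 0 := by exact_mod_cast h
      rw [dslope_of_ne _ hc, slope_def_field, jostKernel, if_neg h]
      simp [hE]
      field_simp
      rw [Complex.I_sq]
      ring
  rw [heq]
  intro lam
  exact ((hs (lam : ℂ)).restrictScalars ℝ).comp lam Complex.ofRealCLM.differentiableAt

lemma prod_gap_le {x : ℤ} {n : ℕ} (t : jostIdxP (x : ℝ) n) :
    ∏ l, (gap x t.1 l : ℝ) ≤ (1 + |(x : ℝ)|) * ∏ l, (1 + |(t.1 l : ℝ)|) := by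
  set c : Fin (n + 2) → ℤ := Fin.cons x t.1 with hc
  let φ : ℤ → ℝ := fun i => 1 + max (-(i : ℝ)) 0
  let ψ : ℤ → ℝ := fun i => 1 + max (i : ℝ) 0
  have hφ : ∀ i, 1 ≤ φ i := fun i => by simp [φ]
  have hψ : ∀ i, 1 ≤ ψ i := fun i => by simp [ψ]
  have hφψ : ∀ i, φ i * ψ i = 1 + |(i : ℝ)| := fun i => by
    rcases le_total (0 : ℝ) i with h | h
    · simp [φ, ψ, h, abs_of_nonneg h]
    · simp [φ, ψ, h, abs_of_nonpos h]
  have h1 : ∀ l, (gap x t.1 l : ℝ) ≤ φ (c l.castSucc) * ψ (c l.succ) := fun l => by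
    rw [gap_eq, ← hc]
    push_cast
    have h1 := le_max_left (-(c l.castSucc : ℝ)) 0
    have h2 := le_max_left (c l.succ : ℝ) 0
    have h3 := mul_nonneg (le_max_right (-(c l.castSucc : ℝ)) 0) (le_max_right (c l.succ : ℝ) 0)
    simp only [φ, ψ]
    linarith
  have hP : ∀ (f : ℤ → ℝ), (∀ i, 1 ≤ f i) → 0 ≤ ∏ i, f (c i) := fun f hf =>
    Finset.prod_nonneg fun i _ => zero_le_one.trans (hf _)
  have h2 : ∏ l : Fin (n + 1), φ (c l.castSucc) ≤ ∏ i, φ (c i) := by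
    rw [Fin.prod_univ_castSucc (fun i => φ (c i))]
    exact le_mul_of_one_le_right
      (Finset.prod_nonneg fun i _ => zero_le_one.trans (hφ _)) (hφ _)
  have h3 : ∏ l : Fin (n + 1), ψ (c l.succ) ≤ ∏ i, ψ (c i) := by
    rw [Fin.prod_univ_succ (fun i => ψ (c i))]
    exact le_mul_of_one_le_left
      (Finset.prod_nonneg fun i _ => zero_le_one.trans (hψ _)) (hψ _)
  calc ∏ l, (gap x t.1 l : ℝ) ≤ ∏ l : Fin (n + 1), φ (c l.castSucc) * ψ (c l.succ) := by
        refine Finset.prod_le_prod (fun l _ => ?_) fun l _ => h1 l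
        exact_mod_cast zero_le_one.trans (one_le_gap t l)
    _ = (∏ l : Fin (n + 1), φ (c l.castSucc)) * ∏ l : Fin (n + 1), ψ (c l.succ) :=
        Finset.prod_mul_distrib
    _ ≤ (∏ i, φ (c i)) * ∏ i, ψ (c i) :=
        mul_le_mul h2 h3 (Finset.prod_nonneg fun i _ => zero_le_one.trans (hψ _)) (hP φ hφ)
    _ = ∏ i, (1 + |(c i : ℝ)|) := by
        rw [← Finset.prod_mul_distrib]
        exact Finset.prod_congr rfl fun i _ => hφψ _
    _ = _ := by rw [Fin.prod_univ_succ]; simp [hc]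

lemma norm_prod_sub_prod_le {ι : Type*} (s : Finset ι) (a b : ι → ℂ) (y : ι → ℝ) {C : ℝ}
    (hC : 0 ≤ C) (hy : ∀ i, 1 ≤ y i) (ha : ∀ i, ‖a i‖ ≤ y i) (hb : ∀ i, ‖b i‖ ≤ y i)
    (hab : ∀ i, ‖a i - b i‖ ≤ C * y i ^ 2) :
    ‖∏ i ∈ s, a i - ∏ i ∈ s, b i‖ ≤ C * s.card * (∏ i ∈ s, y i) ^ 2 := by
  classical
  induction s using Finset.induction_on with
  | empty => simp
  | insert i s his ih =>
    rw [Finset.prod_insert his, Finset.prod_insert his, Finset.prod_insert his,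
      Finset.card_insert_of_notMem his]
    set A := ∏ i ∈ s, a i
    set B := ∏ i ∈ s, b i
    set Y := ∏ i ∈ s, y i
    have hA : ‖A‖ ≤ Y := (Finset.norm_prod_le s a).trans
      (Finset.prod_le_prod (fun _ _ => norm_nonneg _) fun i _ => ha i)
    have hY : 1 ≤ Y := Finset.one_le_prod fun i _ => hy i
    have h1 : a i * A - b i * B = (a i - b i) * A + b i * (A - B) := by ring
    rw [h1]
    calc ‖(a i - b i) * A + b i * (A - B)‖ ≤ ‖a i - b i‖ * ‖A‖ + ‖b i‖ * ‖A - B‖ := by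
          refine (norm_add_le _ _).trans ?_
          rw [norm_mul, norm_mul]
      _ ≤ (C * y i ^ 2) * Y + y i * (C * s.card * Y ^ 2) := by
          have := zero_le_one.trans (hy i)
          gcongr
          · exact hab i
          · exact hb i
      _ ≤ (C * y i ^ 2) * Y ^ 2 + y i ^ 2 * (C * s.card * Y ^ 2) := by
          have h0 := hy i
          gcongr
          · exact le_self_pow₀ hY two_ne_zero
          · exact le_self_pow₀ h0 two_ne_zero
      _ = _ := by push_cast; ring

lemma jostWeight_nonneg (α : ℤ → ℝ) (j : ℤ) : 0 ≤ jostWeight α j := by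
  unfold jostWeight; positivity

lemma summable_jostWeight {α : ℤ → ℝ} (hα : Summable fun j : ℤ => (j : ℝ) ^ 2 * |α j|) :
    Summable (jostWeight α) := by
  refine Summable.of_norm_bounded_eventually (hα.mul_left 8) ?_
  filter_upwards [(Set.finite_singleton (0 : ℤ)).compl_mem_cofinite] with j hj
  have h1 : (1 : ℝ) ≤ |(j : ℝ)| := by exact_mod_cast Int.one_le_abs (by simpa using hj)
  rw [Real.norm_of_nonneg (jostWeight_nonneg α j), jostWeight, ← mul_assoc]
  refine mul_le_mul_of_nonneg_right ?_ (abs_nonneg _)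
  nlinarith [sq_abs (j : ℝ)]

/-- The sums of `∏ w(t_l)` over all strictly increasing tuples converge. -/
lemma summable_prod_strictMono {w : ℤ → ℝ} (hw : ∀ j, 0 ≤ w j) (hs : Summable w) :
    Summable fun p : Σ n : ℕ, {t : Fin (n + 1) → ℤ // StrictMono t} => ∏ l, w (p.2.1 l) := by
  let e : (Σ n : ℕ, {t : Fin (n + 1) → ℤ // StrictMono t}) → Finset ℤ :=
    fun p => Finset.univ.map ⟨p.2.1, p.2.2.injective⟩
  have he : Function.Injective e := by
    rintro ⟨n, t, ht⟩ ⟨m, u, hu⟩ h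
    have hcard : n = m := by simpa [e] using congrArg Finset.card h
    subst hcard
    have h1 : (Finset.univ.map ⟨t, ht.injective⟩ : Finset ℤ).card = n + 1 := by simp
    have h2 := Finset.orderEmbOfFin_unique h1 (f := t) (fun x => by simp) ht
    have h3 := Finset.orderEmbOfFin_unique h1 (f := u)
      (fun x => by
        have : u x ∈ e ⟨n, u, hu⟩ := by simp [e]
        rw [← h] at this
        exact this) hu
    have : t = u := h2.trans h3.symm
    subst this
    rfl
  have h := (summable_finsetProd_of_summable_nonneg hw hs).comp_injective he
  simpa [e, Function.comp_def] using h

lemma summable_prod_jostIdx {w : ℤ → ℝ} (hw : ∀ j, 0 ≤ w j) (hs : Summable w) (x : ℤ) :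
    Summable fun p : JostIdx x => ∏ l, w (p.2.1 l) := by
  have hinj : Function.Injective
      (fun p : JostIdx x => (⟨p.1, p.2.1, p.2.2.1⟩ :
        Σ n : ℕ, {t : Fin (n + 1) → ℤ // StrictMono t})) := by
    rintro ⟨n, t, ht⟩ ⟨m, u, hu⟩ h
    simp only [Sigma.mk.injEq] at h
    obtain ⟨rfl, h⟩ := h
    have : t = u := congrArg Subtype.val (eq_of_heq h)
    subst this
    rfl
  have h := (summable_prod_strictMono hw hs).comp_injective hinj
  exact h.congr fun q => rfl

lemma summable_prod_sigma_jostIdx {w : ℤ → ℝ} (hw : ∀ j, 0 ≤ w j) (hs : Summable w) :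
    Summable fun q : (Σ j : ℤ, JostIdx j) => w q.1 * ∏ l, w (q.2.2.1 l) := by
  have hinj : Function.Injective
      (fun q : (Σ j : ℤ, JostIdx j) =>
        (⟨q.2.1 + 1, Fin.cons q.1 q.2.2.1, strictMono_cons q.2.2⟩ :
        Σ n : ℕ, {t : Fin (n + 1) → ℤ // StrictMono t})) := by
    rintro ⟨i, n, t, ht⟩ ⟨j, m, u, hu⟩ h
    simp only [Sigma.mk.injEq, Nat.add_right_cancel_iff] at h
    obtain ⟨rfl, h⟩ := h
    have h1 : (Fin.cons i t : Fin (n + 2) → ℤ) = Fin.cons j u :=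
      congrArg Subtype.val (eq_of_heq h)
    obtain ⟨rfl, rfl⟩ := Fin.cons_injective2 h1
    rfl
  have h := (summable_prod_strictMono hw hs).comp_injective hinj
  refine h.congr fun q => ?_
  simp [Fin.prod_univ_succ]

lemma jostTerm_eq_mul (α : ℤ → ℝ) (lam : ℝ) (x : ℤ) {n : ℕ} (t : Fin (n + 1) → ℤ) :
    jostTerm α lam x t = (∏ l, (α (t l) : ℂ)) * ∏ l, jostKernel lam (gap x t l) :=
  Finset.prod_mul_distrib

lemma norm_jostKernel_gap_le (lam : ℝ) {x : ℤ} {n : ℕ} (t : jostIdxP (x : ℝ) n)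
    (l : Fin (n + 1)) : ‖jostKernel lam (gap x t.1 l)‖ ≤ gap x t.1 l := by
  refine (norm_jostKernel_le _ _).trans (le_of_eq (abs_of_nonneg ?_))
  exact_mod_cast zero_le_one.trans (one_le_gap t l)

lemma norm_jostTerm_le (α : ℤ → ℝ) (lam : ℝ) {x : ℤ} {n : ℕ} (t : jostIdxP (x : ℝ) n) :
    ‖jostTerm α lam x t.1‖ ≤ (1 + |(x : ℝ)|) * ∏ l, jostWeight α (t.1 l) := by
  rw [jostTerm_eq_mul, norm_mul, norm_prod, norm_prod]
  calc (∏ l, ‖(α (t.1 l) : ℂ)‖) * ∏ l, ‖jostKernel lam (gap x t.1 l)‖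
      ≤ (∏ l, ‖(α (t.1 l) : ℂ)‖) * ((1 + |(x : ℝ)|) * ∏ l, (1 + |(t.1 l : ℝ)|)) := by
        refine mul_le_mul_of_nonneg_left ((Finset.prod_le_prod (fun _ _ => norm_nonneg _)
          fun l _ => norm_jostKernel_gap_le lam t l).trans (prod_gap_le t)) (by positivity)
    _ = (1 + |(x : ℝ)|) * ∏ l, (|α (t.1 l)| * (1 + |(t.1 l : ℝ)|)) := by
        rw [Finset.prod_mul_distrib]
        simp only [Complex.norm_real, Real.norm_eq_abs]
        ring
    _ ≤ _ := by
        refine mul_le_mul_of_nonneg_left (Finset.prod_le_prod (fun _ _ => by positivity)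
          fun l _ => ?_) (by positivity)
        unfold jostWeight
        rw [mul_comm]
        refine mul_le_mul_of_nonneg_right ?_ (abs_nonneg _)
        nlinarith [abs_nonneg (t.1 l : ℝ)]

lemma norm_jostTerm_sub_le (α : ℤ → ℝ) (lam : ℝ) {x : ℤ} {n : ℕ} (t : jostIdxP (x : ℝ) n) :
    ‖jostTerm α lam x t.1 - jostTerm α 0 x t.1‖
      ≤ 4 * |lam| * ((1 + |(x : ℝ)|) ^ 2 * ∏ l, jostWeight α (t.1 l)) := by
  rw [jostTerm_eq_mul, jostTerm_eq_mul, ← mul_sub, norm_mul, norm_prod]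
  have h1 := norm_prod_sub_prod_le Finset.univ (fun l => jostKernel lam (gap x t.1 l))
    (fun l => jostKernel 0 (gap x t.1 l)) (fun l => (gap x t.1 l : ℝ)) (C := 4 * |lam|)
    (by positivity) (fun l => by exact_mod_cast one_le_gap t l)
    (norm_jostKernel_gap_le lam t) (norm_jostKernel_gap_le 0 t)
    (fun l => norm_jostKernel_sub_le lam _)
  have h2 : ((Finset.univ : Finset (Fin (n + 1))).card : ℝ) ≤ ∏ _l : Fin (n + 1), (2 : ℝ) := by
    simp only [Finset.card_univ, Fintype.card_fin, Finset.prod_const]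
    exact_mod_cast Nat.lt_two_pow_self.le
  have h0 : 0 ≤ ∏ l, (gap x t.1 l : ℝ) :=
    Finset.prod_nonneg fun l _ => by exact_mod_cast zero_le_one.trans (one_le_gap t l)
  calc _ ≤ (∏ l, ‖(α (t.1 l) : ℂ)‖) * (4 * |lam| * (∏ _l : Fin (n + 1), (2 : ℝ))
          * ((1 + |(x : ℝ)|) * ∏ l, (1 + |(t.1 l : ℝ)|)) ^ 2) := by
        refine mul_le_mul_of_nonneg_left (h1.trans ?_) (by positivity)
        gcongr
        exact prod_gap_le t
    _ = _ := by
        simp only [jostWeight, Finset.prod_mul_distrib, Finset.prod_pow, Complex.norm_real,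
          Real.norm_eq_abs]
        ring

lemma differentiable_jostTerm (α : ℤ → ℝ) (x : ℤ) {n : ℕ} (t : Fin (n + 1) → ℤ) :
    Differentiable ℝ fun lam : ℝ => jostTerm α lam x t := by
  unfold jostTerm
  have := fun l => differentiable_jostKernel (gap x t l)
  fun_prop

lemma summable_jostTerm {α : ℤ → ℝ} (hα : Summable fun j : ℤ => (j : ℝ) ^ 2 * |α j|)
    (lam : ℝ) (x : ℤ) :
    Summable fun p : JostIdx x => jostTerm α lam x p.2.1 :=
  Summable.of_norm_bounded
    ((summable_prod_jostIdx (jostWeight_nonneg α) (summable_jostWeight hα) x).mul_left _)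
    fun p => norm_jostTerm_le α lam p.2

lemma mPlus_eq_jostSum {α : ℤ → ℝ} (hα : Summable fun j : ℤ => (j : ℝ) ^ 2 * |α j|)
    {lam : ℝ} (h : lam ≠ 0) (x : ℤ) :
    mPlus α (lam : ℂ) (x : ℝ) = jostSum α lam x := by
  unfold mPlus jostSum
  simp_rw [jostTermP_eq α h]
  rw [(summable_jostTerm hα lam x).tsum_sigma]

lemma mPlusZero_eq_jostSum {α : ℤ → ℝ} (hα : Summable fun j : ℤ => (j : ℝ) ^ 2 * |α j|)
    (x : ℤ) : mPlusZero α (x : ℝ) = jostSum α 0 x := by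
  unfold mPlusZero jostSum
  simp_rw [jostTermP0_eq α]
  rw [(summable_jostTerm hα 0 x).tsum_sigma]

/-- An increasing tuple above `x` is its first entry `j > x`, followed by either nothing or an
increasing tuple above `j`. -/
def jostIdxEquiv (x : ℤ) : (Σ j : Set.Ioi x, Unit ⊕ JostIdx (j : ℤ)) ≃ JostIdx x where
  toFun
    | ⟨j, .inl _⟩ => ⟨0, fun _ => j.1, Fin.strictMono_iff_lt_succ.mpr fun i => i.elim0, Int.cast_lt.mpr j.2⟩
    | ⟨j, .inr ⟨n, t⟩⟩ => ⟨n + 1, Fin.cons j.1 t.1, strictMono_cons t, Int.cast_lt.mpr j.2⟩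
  invFun
    | ⟨0, t⟩ => ⟨⟨t.1 0, Int.cast_lt.mp t.2.2⟩, .inl ()⟩
    | ⟨n + 1, t⟩ => ⟨⟨t.1 0, Int.cast_lt.mp t.2.2⟩, .inr ⟨n, Fin.tail t.1,
        t.2.1.comp (Fin.strictMono_succ), Int.cast_lt.mpr (t.2.1 (Fin.succ_pos 0))⟩⟩
  left_inv := by
    rintro ⟨⟨j, hj⟩, _ | ⟨n, t, ht⟩⟩
    · rfl
    · rfl
  right_inv := by
    rintro ⟨_ | n, t, ht⟩
    · have : (fun _ : Fin (0 + 1) => t 0) = t := by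
        funext i; rw [Fin.fin_one_eq_zero i]
      simp only
      congr
    · have : (Fin.cons (t 0) (Fin.tail t) : Fin (n + 1 + 1) → ℤ) = t := Fin.cons_self_tail t
      simp only
      congr

lemma jostTerm_cons (α : ℤ → ℝ) (lam : ℝ) (x j : ℤ) {n : ℕ} (t : Fin (n + 1) → ℤ) :
    jostTerm α lam x (Fin.cons j t : Fin (n + 2) → ℤ)
      = α j * jostKernel lam (j - x) * jostTerm α lam j t := by
  simp only [jostTerm, gap_eq]
  rw [Fin.prod_univ_succ]
  simp

/-- A term of the Jost series as a function on the joint index set. -/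
noncomputable def jostIdxTerm (α : ℤ → ℝ) (lam : ℝ) (x : ℤ) (p : JostIdx x) : ℂ :=
  jostTerm α lam x p.2.1

lemma jostIdxTerm_inl (α : ℤ → ℝ) (lam : ℝ) (x : ℤ) (j : Set.Ioi x) (u : Unit) :
    jostIdxTerm α lam x (jostIdxEquiv x ⟨j, .inl u⟩) = α j * jostKernel lam (j - x) := by
  change ∏ l : Fin 1, (α j : ℂ) * jostKernel lam (gap x (fun _ => j.1) l) = _
  simp [gap]

lemma jostIdxTerm_inr (α : ℤ → ℝ) (lam : ℝ) (x : ℤ) (j : Set.Ioi x) (p : JostIdx j.1) :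
    jostIdxTerm α lam x (jostIdxEquiv x ⟨j, .inr p⟩)
      = α j * jostKernel lam (j - x) * jostIdxTerm α lam j p :=
  jostTerm_cons α lam x j p.2.1

lemma summable_jostIdxTerm {α : ℤ → ℝ} (hα : Summable fun j : ℤ => (j : ℝ) ^ 2 * |α j|)
    (lam : ℝ) (x : ℤ) : Summable (jostIdxTerm α lam x) :=
  summable_jostTerm hα lam x

/-- The discrete Volterra equation. -/
lemma jostSum_eq {α : ℤ → ℝ} (hα : Summable fun j : ℤ => (j : ℝ) ^ 2 * |α j|)
    (lam : ℝ) (x : ℤ) :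
    jostSum α lam x = 1 + ∑' j : ℤ, (Set.Ioi x).indicator
      (fun j => α j * jostKernel lam (j - x) * jostSum α lam j) j := by
  have hs : Summable fun c => jostIdxTerm α lam x (jostIdxEquiv x c) :=
    ((jostIdxEquiv x).summable_iff (f := jostIdxTerm α lam x)).mpr (summable_jostIdxTerm hα lam x)
  have hdef : ∀ y, jostSum α lam y = 1 + ∑' p, jostIdxTerm α lam y p := fun _ => rfl
  rw [← tsum_subtype (Set.Ioi x) fun j : ℤ => α j * jostKernel lam (j - x) * jostSum α lam j,
    hdef x, ← (jostIdxEquiv x).tsum_eq, Summable.tsum_sigma hs]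
  congr 1
  refine tsum_congr fun j => ?_
  have h := (hasSum_fintype fun u : Unit => jostIdxTerm α lam x (jostIdxEquiv x ⟨j, .inl u⟩)).sum
    (f := fun o => jostIdxTerm α lam x (jostIdxEquiv x ⟨j, o⟩))
    (b := α j * jostKernel lam (j - x) * ∑' p, jostIdxTerm α lam j p) (by
      simp only [Function.comp_def, jostIdxTerm_inr]
      exact (summable_jostIdxTerm hα lam j).hasSum.mul_left _)
  rw [h.tsum_eq, hdef]
  simp only [jostIdxTerm_inl, Finset.univ_unique, Finset.sum_singleton]
  ring

lemma norm_jostSum_term_le (α : ℤ → ℝ) (lam : ℝ) (q : Σ j : ℤ, JostIdx j) :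
    ‖(α q.1 : ℂ) * jostTerm α lam q.1 q.2.2.1‖
      ≤ jostWeight α q.1 * ∏ l, jostWeight α (q.2.2.1 l) := by
  have hP : 0 ≤ ∏ l, jostWeight α (q.2.2.1 l) :=
    Finset.prod_nonneg fun _ _ => jostWeight_nonneg α _
  rw [norm_mul, Complex.norm_real, Real.norm_eq_abs]
  refine (mul_le_mul_of_nonneg_left (norm_jostTerm_le α lam q.2.2) (abs_nonneg _)).trans ?_
  rw [← mul_assoc]
  refine mul_le_mul_of_nonneg_right ?_ hP
  unfold jostWeight
  rw [mul_comm]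
  refine mul_le_mul_of_nonneg_right ?_ (abs_nonneg _)
  nlinarith [abs_nonneg (q.1 : ℝ)]

lemma norm_jostSum_term_sub_le (α : ℤ → ℝ) (lam : ℝ) (q : Σ j : ℤ, JostIdx j) :
    ‖(α q.1 : ℂ) * jostTerm α lam q.1 q.2.2.1 - (α q.1 : ℂ) * jostTerm α 0 q.1 q.2.2.1‖
      ≤ 4 * |lam| * (jostWeight α q.1 * ∏ l, jostWeight α (q.2.2.1 l)) := by
  have hP : 0 ≤ ∏ l, jostWeight α (q.2.2.1 l) :=
    Finset.prod_nonneg fun _ _ => jostWeight_nonneg α _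
  have h1 := mul_le_mul_of_nonneg_left (norm_jostTerm_sub_le α lam q.2.2) (abs_nonneg (α q.1))
  rw [← mul_sub, norm_mul, Complex.norm_real, Real.norm_eq_abs]
  refine h1.trans ?_
  generalize ∏ l, jostWeight α (q.2.2.1 l) = P at hP
  have h : |α q.1| * (1 + |(q.1 : ℝ)|) ^ 2 ≤ jostWeight α q.1 := by
    unfold jostWeight
    nlinarith [mul_nonneg (abs_nonneg (α q.1)) (sq_nonneg (1 + |(q.1 : ℝ)|))]
  calc _ = 4 * |lam| * ((|α q.1| * (1 + |(q.1 : ℝ)|) ^ 2) *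
        P) := by ring
    _ ≤ _ := by gcongr

/-- The non-constant part of `∑ α_j m_+(λ,j)`. -/
noncomputable def jostTotal (α : ℤ → ℝ) (lam : ℝ) : ℂ :=
  ∑' q : (Σ j : ℤ, JostIdx j), (α q.1 : ℂ) * jostTerm α lam q.1 q.2.2.1

lemma summable_jostTotal {α : ℤ → ℝ} (hα : Summable fun j : ℤ => (j : ℝ) ^ 2 * |α j|)
    (lam : ℝ) : Summable fun q : (Σ j : ℤ, JostIdx j) =>
      (α q.1 : ℂ) * jostTerm α lam q.1 q.2.2.1 :=
  Summable.of_norm_bounded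
    (summable_prod_sigma_jostIdx (jostWeight_nonneg α) (summable_jostWeight hα))
    (norm_jostSum_term_le α lam)

lemma summable_coe {α : ℤ → ℝ} (hα : Summable fun j : ℤ => (j : ℝ) ^ 2 * |α j|) :
    Summable fun j : ℤ => (α j : ℂ) := by
  refine Summable.of_norm_bounded (summable_jostWeight hα) fun j => ?_
  rw [Complex.norm_real, Real.norm_eq_abs, jostWeight]
  refine le_mul_of_one_le_left (abs_nonneg _) ?_
  nlinarith [abs_nonneg (j : ℝ)]

lemma hasSum_mul_jostSum {α : ℤ → ℝ} (hα : Summable fun j : ℤ => (j : ℝ) ^ 2 * |α j|)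
    (lam : ℝ) : HasSum (fun j : ℤ => (α j : ℂ) * jostSum α lam j)
      (∑' j : ℤ, (α j : ℂ) + jostTotal α lam) := by
  have h := (summable_jostTotal hα lam).hasSum.sigma
    fun j => ((summable_jostTerm hα lam j).mul_left (α j : ℂ)).hasSum
  convert (summable_coe hα).hasSum.add h using 1
  · funext j
    rw [tsum_mul_left, jostSum]
    ring
  · rfl

lemma tsum_indicator_Ioi_sub_one {h : ℤ → ℂ} (hh : Summable h) (n : ℤ) :
    ∑' j, (Set.Ioi (n - 1)).indicator h j = h n + ∑' j, (Set.Ioi n).indicator h j := by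
  have h1 : (Set.Ioi (n - 1)).indicator h = fun j => ({n} : Set ℤ).indicator h j
      + (Set.Ioi n).indicator h j := by
    rw [← Set.indicator_union_of_disjoint (by simp)]
    congr 1
    ext j
    simp only [Set.mem_Ioi, Set.singleton_union, Set.mem_insert_iff]
    omega
  rw [h1, (hh.indicator _).tsum_add (hh.indicator _), ← tsum_subtype ({n} : Set ℤ),
    tsum_singleton]

lemma tendsto_tsum_indicator_Ioi_atTop {h : ℤ → ℂ} (hh : Summable h) :
    Tendsto (fun n : ℤ => ∑' j, (Set.Ioi n).indicator h j) atTop (𝓝 0) := by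
  rw [← tsum_zero (α := ℂ) (β := ℤ)]
  refine tendsto_tsum_of_dominated_convergence hh.norm (fun j => ?_)
    (Eventually.of_forall fun n j => norm_indicator_le_norm_self h j)
  refine tendsto_const_nhds.congr' ?_
  filter_upwards [eventually_ge_atTop j] with n hn
  simp [hn]

lemma tendsto_tsum_indicator_Ioi_atBot {h : ℤ → ℂ} (hh : Summable h) :
    Tendsto (fun n : ℤ => ∑' j, (Set.Ioi n).indicator h j) atBot (𝓝 (∑' j, h j)) := by
  refine tendsto_tsum_of_dominated_convergence hh.norm (fun j => ?_)
    (Eventually.of_forall fun n j => norm_indicator_le_norm_self h j)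
  refine tendsto_const_nhds.congr' ?_
  filter_upwards [eventually_lt_atBot j] with n hn
  simp [hn]

/-- One step of the transfer recursion preserves `|A|² − |B|²`. -/
lemma normSq_sub_normSq_step (A B c E M : ℂ) (a : ℝ) (hc : (starRingEnd ℂ) c = -c)
    (hE : E * (starRingEnd ℂ) E = 1) (hM : M = A + (starRingEnd ℂ) E * B) :
    Complex.normSq (A - c * (a * M)) - Complex.normSq (B + c * (E * (a * M)))
      = Complex.normSq A - Complex.normSq B := by
  have hM' : (starRingEnd ℂ) M = (starRingEnd ℂ) A + E * (starRingEnd ℂ) B := by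
    rw [hM]; simp
  apply Complex.ofReal_injective
  push_cast
  simp only [Complex.normSq_eq_conj_mul_self, map_sub, map_add, map_mul, hc, Complex.conj_ofReal]
  rw [hM', hM]
  linear_combination (c ^ 2 * a ^ 2 * (A + (starRingEnd ℂ) E * B) *
    ((starRingEnd ℂ) A + E * (starRingEnd ℂ) B)) * hE

lemma one_le_norm_of_jost {α : ℤ → ℝ} (hα : Summable fun j : ℤ => (j : ℝ) ^ 2 * |α j|)
    {lam : ℝ} (hlam : lam ≠ 0) :
    1 ≤ ‖1 - 1 / (2 * Complex.I * lam) * ∑' j : ℤ, (α j : ℂ) * jostSum α lam j‖ := by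
  set c : ℂ := 1 / (2 * Complex.I * lam) with hc
  let E : ℤ → ℂ := fun j => Complex.exp (2 * Complex.I * lam * j)
  have htwo : (starRingEnd ℂ) 2 = 2 := Complex.conj_ofNat 2
  have hconj : ∀ j, (starRingEnd ℂ) (E j) = Complex.exp (-(2 * Complex.I * lam * j)) := fun j => by
    simp [E, ← Complex.exp_conj, htwo]
  have hE : ∀ j, E j * (starRingEnd ℂ) (E j) = 1 := fun j => by
    rw [hconj, ← Complex.exp_add]; simp
  have hEn : ∀ j, ‖E j‖ = 1 := fun j => by
    simp [E, Complex.norm_exp]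
  let h1 : ℤ → ℂ := fun j => α j * jostSum α lam j
  let h2 : ℤ → ℂ := fun j => E j * (α j * jostSum α lam j)
  have hs1 : Summable h1 := (hasSum_mul_jostSum hα lam).summable
  have hs2 : Summable h2 := Summable.of_norm_bounded hs1.norm fun j => by
    simp [h1, h2, hEn]
  let A : ℤ → ℂ := fun n => 1 - c * ∑' j, (Set.Ioi n).indicator h1 j
  let B : ℤ → ℂ := fun n => c * ∑' j, (Set.Ioi n).indicator h2 j
  have hM : ∀ n, jostSum α lam n = A n + (starRingEnd ℂ) (E n) * B n := fun n => by
    rw [jostSum_eq hα]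
    have : ∀ j, (Set.Ioi n).indicator
        (fun j => (α j : ℂ) * jostKernel lam (j - n) * jostSum α lam j) j
        = (starRingEnd ℂ) (E n) * c * (Set.Ioi n).indicator h2 j
          - c * (Set.Ioi n).indicator h1 j := fun j => by
      by_cases hj : j ∈ Set.Ioi n
      · simp only [Set.indicator_of_mem hj, jostKernel, if_neg hlam, h1, h2]
        have he : Complex.exp (2 * Complex.I * lam * ((j - n : ℤ) : ℂ))
            = (starRingEnd ℂ) (E n) * E j := by
          rw [hconj, ← Complex.exp_add]
          congr 1
          push_cast
          ring
        rw [he, hc]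
        ring
      · simp [Set.indicator_of_notMem hj]
    simp_rw [this]
    rw [((hs2.indicator _).mul_left _).tsum_sub ((hs1.indicator _).mul_left _), tsum_mul_left,
      tsum_mul_left]
    simp only [A, B]
    ring
  have hcc : (starRingEnd ℂ) c = -c := by simp [hc, htwo]
  have hstep : ∀ n, Complex.normSq (A (n - 1)) - Complex.normSq (B (n - 1))
      = Complex.normSq (A n) - Complex.normSq (B n) := fun n => by
    rw [← normSq_sub_normSq_step (A n) (B n) c (E n) _ (α n) hcc (hE n) (hM n)]
    simp only [A, B, tsum_indicator_Ioi_sub_one hs1, tsum_indicator_Ioi_sub_one hs2]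
    congr 2 <;> simp only [h1, h2] <;> ring
  have hconst : ∀ n, Complex.normSq (A n) - Complex.normSq (B n)
      = Complex.normSq (A 0) - Complex.normSq (B 0) := fun n => by
    induction n using Int.induction_on with
    | zero => rfl
    | succ n ih => rw [← ih, ← hstep (n + 1), add_sub_cancel_right]
    | pred n ih => rw [← ih, hstep]
  have hlim : ∀ {l : Filter ℤ} {a b : ℂ}, Tendsto A l (𝓝 a) → Tendsto B l (𝓝 b) →
      Tendsto (fun n => Complex.normSq (A n) - Complex.normSq (B n)) l
        (𝓝 (Complex.normSq a - Complex.normSq b)) := fun hA hB =>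
    ((Complex.continuous_normSq.tendsto _).comp hA).sub
      ((Complex.continuous_normSq.tendsto _).comp hB)
  have ht := hlim
    (((tendsto_tsum_indicator_Ioi_atTop hs1).const_mul c).const_sub 1)
    ((tendsto_tsum_indicator_Ioi_atTop hs2).const_mul c)
  have hb := hlim
    (((tendsto_tsum_indicator_Ioi_atBot hs1).const_mul c).const_sub 1)
    ((tendsto_tsum_indicator_Ioi_atBot hs2).const_mul c)
  simp_rw [hconst] at ht hb
  have e1 := tendsto_nhds_unique ht tendsto_const_nhds
  have e2 := tendsto_nhds_unique hb tendsto_const_nhds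
  have e3 : 1 ≤ Complex.normSq (1 - c * ∑' j, h1 j) := by
    have := Complex.normSq_nonneg (c * ∑' j, h2 j)
    simp at e1
    linarith
  rw [Complex.normSq_eq_norm_sq] at e3
  exact (one_le_sq_iff₀ (norm_nonneg _)).mp e3

lemma continuous_jostTotal {α : ℤ → ℝ} (hα : Summable fun j : ℤ => (j : ℝ) ^ 2 * |α j|) :
    Continuous (jostTotal α) := by
  unfold jostTotal
  exact continuous_tsum
    (fun q => ((differentiable_jostTerm α q.1 q.2.2.1).const_mul (α q.1 : ℂ)).continuous)
    (summable_prod_sigma_jostIdx (jostWeight_nonneg α) (summable_jostWeight hα))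
    fun q lam => norm_jostSum_term_le α lam q

lemma exists_hasDerivAt_jostTotal {α : ℤ → ℝ}
    (hα : Summable fun j : ℤ => (j : ℝ) ^ 2 * |α j|) :
    ∃ L : ℂ, HasDerivAt (jostTotal α) L 0 := by
  let g : (Σ j : ℤ, JostIdx j) → ℝ → ℂ := fun q lam => (α q.1 : ℂ) * jostTerm α lam q.1 q.2.2.1
  have hd : ∀ q, Differentiable ℝ (g q) := fun q =>
    (differentiable_jostTerm α q.1 q.2.2.1).const_mul (α q.1 : ℂ)
  refine ⟨∑' q, deriv (g q) 0, ?_⟩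
  rw [hasDerivAt_iff_tendsto_slope]
  have hs : slope (jostTotal α) 0 = fun lam => ∑' q, slope (g q) 0 lam := by
    funext lam
    simp only [slope_def_module, jostTotal, sub_zero]
    rw [← (summable_jostTotal hα lam).tsum_sub (summable_jostTotal hα 0), tsum_const_smul'']
  rw [hs]
  refine tendsto_tsum_of_dominated_convergence
    ((summable_prod_sigma_jostIdx (jostWeight_nonneg α) (summable_jostWeight hα)).mul_left 4)
    (fun q => (hd q 0).hasDerivAt.tendsto_slope) ?_
  filter_upwards [self_mem_nhdsWithin] with lam hlam q
  have hpos : 0 < |lam| := abs_pos.mpr hlam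
  rw [slope_def_module, norm_smul, sub_zero, norm_inv, Real.norm_eq_abs, inv_mul_le_iff₀ hpos]
  refine (norm_jostSum_term_sub_le α lam q).trans (le_of_eq ?_)
  ring

lemma bCoef_eq {α : ℤ → ℝ} (hα : Summable fun j : ℤ => (j : ℝ) ^ 2 * |α j|) {lam : ℝ}
    (h : lam ≠ 0) :
    bCoef α lam = 1 - 1 / (2 * Complex.I * lam) * ∑' j : ℤ, (α j : ℂ) * jostSum α lam j := by
  unfold bCoef
  simp_rw [mPlus_eq_jostSum hα h]

lemma one_le_norm_bCoef {α : ℤ → ℝ} (hα : Summable fun j : ℤ => (j : ℝ) ^ 2 * |α j|) {lam : ℝ}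
    (h : lam ≠ 0) : 1 ≤ ‖bCoef α lam‖ := by
  rw [bCoef_eq hα h]
  exact one_le_norm_of_jost hα h

lemma continuousOn_bCoef {α : ℤ → ℝ} (hα : Summable fun j : ℤ => (j : ℝ) ^ 2 * |α j|) :
    ContinuousOn (bCoef α) {lam : ℝ | lam ≠ 0} := by
  have h : ContinuousOn (fun lam : ℝ => (1 : ℂ) - 1 / (2 * Complex.I * lam) *
      (∑' j : ℤ, (α j : ℂ) + jostTotal α lam)) {lam : ℝ | lam ≠ 0} := by
    have := continuous_jostTotal hα
    refine continuousOn_const.sub (ContinuousOn.mul (continuousOn_const.div (by fun_prop) ?_)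
      (by fun_prop))
    intro lam hlam
    simpa using hlam
  refine h.congr fun lam hlam => ?_
  rw [bCoef_eq hα hlam, (hasSum_mul_jostSum hα lam).tsum_eq]

lemma exists_tendsto_bCoef {α : ℤ → ℝ} (hα : Summable fun j : ℤ => (j : ℝ) ^ 2 * |α j|)
    (hres : ∑' j : ℤ, (α j : ℂ) * mPlusZero α (j : ℝ) = 0) :
    ∃ b0 : ℂ, Tendsto (bCoef α) (𝓝[≠] 0) (𝓝 b0) := by
  obtain ⟨L, hL⟩ := exists_hasDerivAt_jostTotal hα
  simp_rw [mPlusZero_eq_jostSum hα] at hres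
  rw [(hasSum_mul_jostSum hα 0).tsum_eq] at hres
  refine ⟨1 - 1 / (2 * Complex.I) * L, ?_⟩
  refine ((hL.tendsto_slope.const_mul (1 / (2 * Complex.I))).const_sub 1).congr' ?_
  filter_upwards [self_mem_nhdsWithin] with lam hlam
  rw [bCoef_eq hα hlam, (hasSum_mul_jostSum hα lam).tsum_eq, slope_def_module, sub_zero,
    Complex.real_smul, eq_neg_of_add_eq_zero_left hres]
  push_cast
  rw [one_div, one_div, mul_inv]
  ring

/-- For `α ∈ ℓ^{1,2}(ℤ)` with `Σ_j α_j m_+(0,j) = 0` (no zero-energy resonance is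
excluded, i.e. the resonant case), the limit `b₀ = lim_{λ→0, λ≠0} b(λ)` exists and
`|b₀| ≥ 1`; consequently `b` is continuous on `ℝ ∖ {0}` and `1/b` extends to a
continuous nowhere-vanishing function on `ℝ`. -/
theorem statement16 (α : ℤ → ℝ) (hα : Summable fun j : ℤ => (j : ℝ) ^ 2 * |α j|)
    (hres : ∑' j : ℤ, (α j : ℂ) * mPlusZero α (j : ℝ) = 0) :
    ∃ b0 : ℂ,
      Tendsto (fun lam : ℝ => bCoef α lam) (nhdsWithin 0 {0}ᶜ) (nhds b0) ∧
      1 ≤ ‖b0‖ ∧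
      ContinuousOn (bCoef α) {lam : ℝ | lam ≠ 0} ∧
      ∃ g : ℝ → ℂ, Continuous g ∧ (∀ lam : ℝ, g lam ≠ 0) ∧
        ∀ lam : ℝ, lam ≠ 0 → g lam = 1 / bCoef α lam := by
  obtain ⟨b0, hb0⟩ := exists_tendsto_bCoef hα hres
  have h1 : 1 ≤ ‖b0‖ := by
    refine ge_of_tendsto hb0.norm ?_
    filter_upwards [self_mem_nhdsWithin] with lam hlam using one_le_norm_bCoef hα hlam
  have hne : b0 ≠ 0 := norm_pos_iff.mp (zero_lt_one.trans_le h1)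
  have hbne : ∀ lam : ℝ, lam ≠ 0 → bCoef α lam ≠ 0 := fun lam h =>
    norm_pos_iff.mp (zero_lt_one.trans_le (one_le_norm_bCoef hα h))
  have hcont := continuousOn_bCoef hα
  refine ⟨b0, hb0, h1, hcont, Function.update (fun lam => 1 / bCoef α lam) 0 (1 / b0), ?_, ?_, ?_⟩
  · rw [continuous_iff_continuousAt]
    intro lam
    by_cases h : lam = 0
    · subst h
      exact continuousAt_update_same.mpr (tendsto_const_nhds.div hb0 hne)
    · rw [continuousAt_update_of_ne h]
      exact continuousAt_const.div (hcont.continuousAt (isOpen_ne.mem_nhds h)) (hbne lam h)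
  · intro lam
    by_cases h : lam = 0
    · subst h
      simpa using hne
    · simpa [h] using hbne lam h
  · intro lam h
    simp [h]
end

section
/- Assume α ∈ ℓ^{1,1}(ℤ). Then for every x ≥ 0 there exists a finite complex Borel measure μ_x on ℝ, supported in [0, ∞), such that m_+(λ, x) = 1 + ∫ e^{2iλξ} dμ_x(ξ) for every λ ∈ ℝ∖{0}, and sup_{x≥0} ‖μ_x‖ < ∞, where ‖·‖ denotes the total variation norm. Likewise, for every x ≤ 0 there exists a finite complex Borel measure ν_x on ℝ, supported in [0, ∞), such that m_−(λ, x) = 1 + ∫ e^{2iλξ} dν_x(ξ) for every λ ∈ ℝ∖{0}, and sup_{x≤0} ‖ν_x‖ < ∞. If moreover α ∈ ℓ^{1,2}(ℤ), then also sup_{x≥0} ∫ ξ d|μ_x|(ξ) < ∞ and sup_{x≤0} ∫ ξ d|ν_x|(ξ) < ∞, where |μ_x|, |ν_x| denote the total variation measures. -/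
open Complex Filter MeasureTheory
open scoped ENNReal

/-- The summand of the series defining `m_−(λ,x)`, indexed by a decreasing tuple
`j : Fin (n+1) → ℤ` (with the convention `j₀ = x`):
`∏_{l} α_{j_l} (e^{−2iλ(j_l − j_{l−1})} − 1)/(2iλ)`. -/
noncomputable def jostTermM (α : ℤ → ℝ) (lam : ℂ) (x : ℝ) {n : ℕ} (j : Fin (n + 1) → ℤ) : ℂ :=
  ∏ l : Fin (n + 1),
    (α (j l) : ℂ) *
      ((Complex.exp (-(2 * Complex.I * lam) *
          ((j l : ℂ) - (Fin.cons (x : ℂ) (fun k : Fin n => ((j k.castSucc : ℤ) : ℂ)) : Fin (n + 1) → ℂ) l)) - 1) /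
        (2 * Complex.I * lam))

/-- The index set for `m_−(λ,x)`: strictly decreasing integer tuples below `x`. -/
def jostIdxM (x : ℝ) (n : ℕ) : Type :=
  {j : Fin (n + 1) → ℤ // StrictAnti j ∧ ((j 0 : ℤ) : ℝ) < x}

/-- `m_−(λ, x) = 1 + Σ_{n≥1} Σ_{j_n<⋯<j₁<x} ∏_l α_{j_l} (e^{−2iλ(j_l−j_{l−1})}−1)/(2iλ)`. -/
noncomputable def mMinus (α : ℤ → ℝ) (lam : ℂ) (x : ℝ) : ℂ :=
  1 + ∑' (n : ℕ) (j : jostIdxM x n), jostTermM α lam x j.1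

theorem norm_exp_two_I_mul (lam ξ : ℝ) : ‖Complex.exp (2 * Complex.I * lam * ξ)‖ = 1 := by
  rw [show 2 * Complex.I * lam * ξ = ((2 * lam * ξ : ℝ) : ℂ) * Complex.I by push_cast; ring,
    Complex.norm_exp_ofReal_mul_I]

/-- A countable `L¹`-summable family of densities on `[0,∞)` sums to a complex measure given in
polar form, whose Fourier transform is the sum of the Fourier transforms. -/
theorem exists_polar_measure_of_tsum_lintegral_ne_top {ι : Type*} [Countable ι]
    (H : ι → ℝ → ℂ) (hH : ∀ i, AEMeasurable (H i)) (hneg : ∀ i, ∀ ξ < 0, H i ξ = 0)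
    (hsum : ∑' i, ∫⁻ ξ, ‖H i ξ‖ₑ ≠ ∞) :
    ∃ (μ : Measure ℝ) (f : ℝ → ℂ), IsFiniteMeasure μ ∧ (∀ ξ, ‖f ξ‖ = 1) ∧ Measurable f ∧
      μ (Set.Iio 0) = 0 ∧ μ Set.univ ≤ ∑' i, ∫⁻ ξ, ‖H i ξ‖ₑ ∧
      ∫⁻ ξ, ENNReal.ofReal ξ ∂μ ≤ ∑' i, ∫⁻ ξ, ENNReal.ofReal ξ * ‖H i ξ‖ₑ ∧
      ∀ lam : ℝ, ∑' i, ∫ ξ : ℝ, Complex.exp (2 * Complex.I * lam * ξ) * H i ξ =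
        ∫ ξ : ℝ, Complex.exp (2 * Complex.I * lam * ξ) * f ξ ∂μ := by
  classical
  have hKm : AEMeasurable (fun ξ => ∑' i, H i ξ) := AEMeasurable.tsum hH
  obtain ⟨K, hK, hKe⟩ : ∃ K : ℝ → ℂ, Measurable K ∧ (fun ξ => ∑' i, H i ξ) =ᵐ[volume] K :=
    ⟨hKm.mk, hKm.measurable_mk, hKm.ae_eq_mk⟩
  have hbound : ∀ᵐ ξ, ‖K ξ‖ₑ ≤ ∑' i, ‖H i ξ‖ₑ := by
    filter_upwards [hKe] with ξ hξ
    rw [← hξ]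
    exact enorm_tsum_le_tsum_enorm
  have huniv : (volume.withDensity fun ξ => ‖K ξ‖ₑ) Set.univ ≤ ∑' i, ∫⁻ ξ, ‖H i ξ‖ₑ := by
    rw [withDensity_apply _ MeasurableSet.univ, Measure.restrict_univ,
      ← lintegral_tsum fun i => (hH i).enorm]
    exact lintegral_mono_ae hbound
  refine ⟨volume.withDensity fun ξ => ‖K ξ‖ₑ, fun ξ => if K ξ = 0 then 1 else K ξ / (‖K ξ‖ : ℂ),
    ⟨huniv.trans_lt hsum.lt_top⟩, fun ξ => ?_, ?_, ?_, huniv, ?_, fun lam => ?_⟩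
  · dsimp only
    split_ifs with h
    · simp
    · simp [h]
  · exact Measurable.ite (hK (measurableSet_singleton 0)) measurable_const
      (hK.div (Complex.measurable_ofReal.comp hK.norm))
  · rw [withDensity_apply _ measurableSet_Iio, lintegral_eq_zero_iff hK.enorm, Filter.EventuallyEq,
      ae_restrict_iff' measurableSet_Iio]
    filter_upwards [hKe] with ξ hξ h0
    simp [← hξ, hneg _ ξ h0]
  · rw [lintegral_withDensity_eq_lintegral_mul _ hK.enorm ENNReal.measurable_ofReal,
      ← lintegral_tsum (f := fun i ξ => ENNReal.ofReal ξ * ‖H i ξ‖ₑ)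
        fun i => ENNReal.measurable_ofReal.aemeasurable.mul (hH i).enorm]
    refine lintegral_mono_ae ?_
    filter_upwards [hbound] with ξ hξ
    rw [ENNReal.tsum_mul_left, Pi.mul_apply, mul_comm]
    gcongr
  · have hexp : ∀ ξ : ℝ, ‖Complex.exp (2 * Complex.I * lam * ξ)‖ₑ = 1 := fun ξ => by
      rw [← ofReal_norm, norm_exp_two_I_mul, ENNReal.ofReal_one]
    rw [integral_withDensity_eq_integral_toReal_smul hK.enorm (by simp), ← integral_tsum]
    · refine integral_congr_ae ?_
      filter_upwards [hKe] with ξ hξ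
      rw [tsum_mul_left, hξ, toReal_enorm, Complex.real_smul]
      split_ifs with h
      · simp [h]
      · have : (‖K ξ‖ : ℂ) ≠ 0 := by simpa using h
        field_simp
    · intro i
      exact (Continuous.aestronglyMeasurable (by fun_prop)).mul (hH i).aestronglyMeasurable
    · simpa only [enorm_mul, hexp, one_mul] using hsum

theorem integrable_exp_mul {H : ℝ → ℂ} (hH : Integrable H) (lam : ℝ) :
    Integrable fun ξ : ℝ => Complex.exp (2 * Complex.I * lam * ξ) * H ξ := by
  exact hH.bdd_mul (c := 1) (Continuous.aestronglyMeasurable (by fun_prop))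
    (.of_forall fun ξ => (norm_exp_two_I_mul lam ξ).le)

theorem integral_exp_mul_indicator {d : ℝ} (hd : 0 ≤ d) {lam : ℝ} (hlam : lam ≠ 0) (c : ℂ) :
    ∫ ξ : ℝ, Complex.exp (2 * Complex.I * lam * ξ) * (Set.Ioc 0 d).indicator (fun _ => c) ξ =
      c * ((Complex.exp (2 * Complex.I * lam * d) - 1) / (2 * Complex.I * lam)) := by
  have hne : 2 * Complex.I * (lam : ℂ) ≠ 0 := by simp [hlam]
  have hind : ∀ ξ : ℝ, Complex.exp (2 * Complex.I * lam * ξ) *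
      (Set.Ioc 0 d).indicator (fun _ => c) ξ =
      (Set.Ioc 0 d).indicator (fun ξ : ℝ => Complex.exp (2 * Complex.I * lam * ξ) * c) ξ :=
    fun ξ => (Set.indicator_mul_right _ (fun ξ : ℝ => Complex.exp (2 * Complex.I * lam * ξ))
      fun _ => c).symm
  simp_rw [hind]
  rw [integral_indicator measurableSet_Ioc, integral_mul_const,
    ← intervalIntegral.integral_of_le hd, integral_exp_mul_complex hne]
  simp [mul_comm]

theorem integral_exp_mul_convolution {H L : ℝ → ℂ} (hH : Integrable H) (hL : Integrable L)
    (lam : ℝ) :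
    ∫ ξ : ℝ, Complex.exp (2 * Complex.I * lam * ξ) *
        (MeasureTheory.convolution H L (ContinuousLinearMap.mul ℂ ℂ) volume) ξ =
      (∫ ξ : ℝ, Complex.exp (2 * Complex.I * lam * ξ) * H ξ) *
        ∫ ξ : ℝ, Complex.exp (2 * Complex.I * lam * ξ) * L ξ := by
  refine Eq.trans ?_ (integral_convolution (ContinuousLinearMap.mul ℂ ℂ)
    (integrable_exp_mul hH lam) (integrable_exp_mul hL lam))
  congr 1 with ξ
  simp only [convolution_def, ContinuousLinearMap.mul_apply']
  rw [← integral_const_mul]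
  congr 1 with t
  rw [show 2 * Complex.I * lam * ξ =
    2 * Complex.I * lam * t + 2 * Complex.I * lam * ((ξ - t : ℝ) : ℂ) by push_cast; ring,
    Complex.exp_add]
  ring

theorem lintegral_enorm_convolution_le {H L : ℝ → ℂ} (hH : Integrable H) (hL : Integrable L) :
    ∫⁻ ξ, ‖(MeasureTheory.convolution H L (ContinuousLinearMap.mul ℂ ℂ) volume) ξ‖ₑ ≤
      (∫⁻ ξ, ‖H ξ‖ₑ) * ∫⁻ ξ, ‖L ξ‖ₑ := by
  calc _ ≤ ∫⁻ ξ, ∫⁻ t, ‖H t * L (ξ - t)‖ₑ := by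
        refine lintegral_mono fun ξ => ?_
        simp only [convolution_def, ContinuousLinearMap.mul_apply']
        exact enorm_integral_le_lintegral_enorm _
    _ = ∫⁻ t, ∫⁻ ξ, ‖H t * L (ξ - t)‖ₑ :=
        lintegral_lintegral_swap
          (hH.convolution_integrand (ContinuousLinearMap.mul ℂ ℂ) hL).aestronglyMeasurable.enorm
    _ = _ := by
        simp_rw [enorm_mul]
        rw [← lintegral_mul_const'' _ hH.aestronglyMeasurable.enorm]
        congr 1 with t
        rw [lintegral_const_mul' _ _ (by simp), lintegral_sub_right_eq_self fun ξ => ‖L ξ‖ₑ]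

/-- A product of factors `c (e^{2iλd} - 1)/(2iλ)` with `d ≥ 0` is the Fourier transform of an
integrable function supported in `[0, ∏ (1 + d)]`, with `L¹` norm at most `∏ ‖c‖ d`. -/
theorem exists_density_of_prod (n : ℕ) (c : Fin (n + 1) → ℂ) (d : Fin (n + 1) → ℝ)
    (hd : ∀ l, 0 ≤ d l) :
    ∃ H : ℝ → ℂ, Integrable H ∧ (∀ ξ < 0, H ξ = 0) ∧ (∀ ξ, ∏ l, (1 + d l) < ξ → H ξ = 0) ∧
      ∫⁻ ξ, ‖H ξ‖ₑ ≤ ENNReal.ofReal (∏ l, ‖c l‖ * d l) ∧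
      ∀ lam : ℝ, lam ≠ 0 → ∫ ξ : ℝ, Complex.exp (2 * Complex.I * lam * ξ) * H ξ =
        ∏ l, c l * ((Complex.exp (2 * Complex.I * lam * d l) - 1) / (2 * Complex.I * lam)) := by
  have hint : ∀ (a : ℂ) (r : ℝ), Integrable ((Set.Ioc 0 r).indicator fun _ => a) := fun a r =>
    (integrable_indicator_iff measurableSet_Ioc).2 (integrableOn_const (by simp))
  have hnorm : ∀ (a : ℂ) (r : ℝ), ∫⁻ ξ, ‖(Set.Ioc 0 r).indicator (fun _ => a) ξ‖ₑ =
      ENNReal.ofReal (‖a‖ * r) := fun a r => by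
    simp_rw [enorm_indicator_eq_indicator_enorm]
    rw [lintegral_indicator measurableSet_Ioc, setLIntegral_const, Real.volume_Ioc, sub_zero,
      ENNReal.ofReal_mul (norm_nonneg _), ofReal_norm]
  induction n with
  | zero =>
    refine ⟨(Set.Ioc 0 (d 0)).indicator fun _ => c 0, hint _ _, fun ξ hξ => ?_, fun ξ hξ => ?_, ?_,
      fun lam hlam => ?_⟩
    · exact Set.indicator_of_notMem (fun h => hξ.not_gt h.1) _
    · refine Set.indicator_of_notMem (fun h => hξ.not_ge ?_) _
      simp only [Nat.reduceAdd, Fin.isValue, Finset.univ_unique, Fin.default_eq_zero,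
        Finset.prod_singleton]
      linarith [h.2]
    · simp [hnorm]
    · simpa using integral_exp_mul_indicator (hd 0) hlam (c 0)
  | succ n ih =>
    obtain ⟨H, hi, hneg, hsupp, hle, hF⟩ := ih (fun l => c l.succ) (fun l => d l.succ)
      fun l => hd _
    have hP : 1 ≤ ∏ l : Fin (n + 1), (1 + d l.succ) :=
      Finset.one_le_prod fun l _ => by linarith [hd l.succ]
    refine ⟨MeasureTheory.convolution ((Set.Ioc 0 (d 0)).indicator fun _ => c 0) H
      (ContinuousLinearMap.mul ℂ ℂ) volume, (hint _ _).integrable_convolution _ hi, fun ξ hξ => ?_,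
      fun ξ hξ => ?_, ?_, fun lam hlam => ?_⟩
    · rw [convolution_def]
      refine integral_eq_zero_of_ae (.of_forall fun t => ?_)
      by_cases ht : t ∈ Set.Ioc 0 (d 0)
      · simp [hneg (ξ - t) (by linarith [ht.1])]
      · simp [Set.indicator_of_notMem ht]
    · rw [convolution_def]
      refine integral_eq_zero_of_ae (.of_forall fun t => ?_)
      by_cases ht : t ∈ Set.Ioc 0 (d 0)
      · have : ∏ l : Fin (n + 1), (1 + d l.succ) < ξ - t := by
          rw [Fin.prod_univ_succ] at hξ
          nlinarith [ht.2, hd 0]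
        simp [hsupp (ξ - t) this]
      · simp [Set.indicator_of_notMem ht]
    · refine (lintegral_enorm_convolution_le (hint _ _) hi).trans ?_
      rw [Fin.prod_univ_succ, ENNReal.ofReal_mul (mul_nonneg (norm_nonneg _) (hd 0)), hnorm]
      gcongr
    · rw [integral_exp_mul_convolution (hint _ _) hi, integral_exp_mul_indicator (hd 0) hlam,
        hF lam hlam, ← Fin.prod_univ_succ fun l =>
          c l * ((Complex.exp (2 * Complex.I * lam * d l) - 1) / (2 * Complex.I * lam))]

/-- For `x ≥ 0`, each term of the Jost series is the Fourier transform of an integrable function on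
`[0,∞)` whose norm and first moment are controlled by products of weights of `α`. -/
theorem exists_density_jostTermP (α : ℤ → ℝ) {x : ℝ} (hx : 0 ≤ x) {n : ℕ} {j : Fin (n + 1) → ℤ}
    (hj : StrictMono j) (hxj : x < j 0) :
    ∃ H : ℝ → ℂ, Integrable H ∧ (∀ ξ < 0, H ξ = 0) ∧
      ∫⁻ ξ, ‖H ξ‖ₑ ≤ ∏ l, ENNReal.ofReal (|(j l : ℝ)| * |α (j l)|) ∧
      ∫⁻ ξ, ENNReal.ofReal ξ * ‖H ξ‖ₑ ≤
        ∏ l, ENNReal.ofReal ((1 + |(j l : ℝ)|) * (|(j l : ℝ)| * |α (j l)|)) ∧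
      ∀ lam : ℝ, lam ≠ 0 → ∫ ξ : ℝ, Complex.exp (2 * Complex.I * lam * ξ) * H ξ =
        jostTermP α lam x j := by
  obtain ⟨p, hp⟩ : ∃ p : Fin (n + 1) → ℝ, p = Fin.cons x fun k : Fin n => (j k.castSucc : ℝ) :=
    ⟨_, rfl⟩
  have hpj : ∀ l, 0 ≤ p l ∧ p l ≤ j l := fun l => by
    have hpos : ∀ l, 0 ≤ (j l : ℝ) := fun l =>
      hx.trans (hxj.le.trans (Int.cast_le.2 (hj.monotone (Fin.zero_le l))))
    subst hp
    refine Fin.cases ?_ (fun k => ?_) l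
    · exact ⟨by simpa using hx, by simpa using hxj.le⟩
    · simp only [Fin.cons_succ]
      exact ⟨hpos _, Int.cast_le.2 (hj.monotone (Fin.castSucc_lt_succ).le)⟩
  have hpC : ∀ l, (Fin.cons (x : ℂ) (fun k : Fin n => ((j k.castSucc : ℤ) : ℂ)) :
      Fin (n + 1) → ℂ) l = (p l : ℂ) := fun l => by
    subst hp
    refine Fin.cases ?_ (fun k => ?_) l <;> simp
  have hd : ∀ l, 0 ≤ (j l : ℝ) - p l ∧ (j l : ℝ) - p l ≤ |(j l : ℝ)| := fun l =>
    ⟨sub_nonneg.2 (hpj l).2, (sub_le_self _ (hpj l).1).trans (le_abs_self _)⟩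
  obtain ⟨H, hi, hneg, hsupp, hle, hF⟩ :=
    exists_density_of_prod n (fun l => (α (j l) : ℂ)) (fun l => (j l : ℝ) - p l) fun l => (hd l).1
  have hnorm : ∫⁻ ξ, ‖H ξ‖ₑ ≤ ∏ l, ENNReal.ofReal (|(j l : ℝ)| * |α (j l)|) := by
    refine hle.trans ?_
    rw [← ENNReal.ofReal_prod_of_nonneg fun l _ => by positivity]
    refine ENNReal.ofReal_le_ofReal (Finset.prod_le_prod
      (fun l _ => mul_nonneg (norm_nonneg _) (hd l).1) fun l _ => ?_)
    rw [Complex.norm_real, Real.norm_eq_abs, mul_comm]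
    exact mul_le_mul_of_nonneg_right (hd l).2 (abs_nonneg _)
  refine ⟨H, hi, hneg, hnorm, ?_, fun lam hlam => ?_⟩
  · calc ∫⁻ ξ, ENNReal.ofReal ξ * ‖H ξ‖ₑ
        ≤ ∫⁻ ξ, (∏ l, ENNReal.ofReal (1 + |(j l : ℝ)|)) * ‖H ξ‖ₑ := by
          refine lintegral_mono fun ξ => ?_
          rw [← ENNReal.ofReal_prod_of_nonneg fun l _ => by positivity]
          by_cases hξ : ∏ l, (1 + ((j l : ℝ) - p l)) < ξ
          · simp [hsupp ξ hξ]
          · dsimp only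
            gcongr
            refine (not_lt.1 hξ).trans (Finset.prod_le_prod (fun l _ => ?_) fun l _ => ?_)
            · linarith [(hd l).1]
            · linarith [(hd l).2]
      _ = (∏ l, ENNReal.ofReal (1 + |(j l : ℝ)|)) * ∫⁻ ξ, ‖H ξ‖ₑ :=
          lintegral_const_mul'' _ hi.aestronglyMeasurable.enorm
      _ ≤ (∏ l, ENNReal.ofReal (1 + |(j l : ℝ)|)) *
            ∏ l, ENNReal.ofReal (|(j l : ℝ)| * |α (j l)|) := by gcongr
      _ = _ := by
          rw [← Finset.prod_mul_distrib]
          exact Finset.prod_congr rfl fun l _ => (ENNReal.ofReal_mul (by positivity)).symm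
  · rw [hF lam hlam, jostTermP]
    refine Finset.prod_congr rfl fun l _ => ?_
    rw [hpC]
    push_cast
    rfl

instance (x : ℝ) (n : ℕ) : Countable (jostIdxP x n) :=
  inferInstanceAs (Countable {j : Fin (n + 1) → ℤ // StrictMono j ∧ x < ((j 0 : ℤ) : ℝ)})

theorem injective_image_jostIdxP (x : ℝ) :
    Function.Injective fun q : Σ n, jostIdxP x n => Finset.univ.image q.2.1 := by
  rintro ⟨n, j, hj, _⟩ ⟨m, k, hk, _⟩ h
  dsimp only at h
  have hnm : n = m := by
    have := congrArg Finset.card h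
    simpa [Finset.card_image_of_injective _ hj.injective,
      Finset.card_image_of_injective _ hk.injective] using this
  subst hnm
  have hjk : j = k := (hj.range_inj hk).1
    (by simpa using congrArg (fun s : Finset ℤ => (s : Set ℤ)) h)
  subst hjk
  rfl

theorem tsum_prod_jostIdxP_le (w : ℤ → ℝ≥0∞) (x : ℝ) :
    ∑' q : Σ n, jostIdxP x n, ∏ l, w (q.2.1 l) ≤ ∑' s : Finset ℤ, ∏ i ∈ s, w i := by
  refine le_trans (le_of_eq ?_) (ENNReal.tsum_comp_le_tsum_of_injective
    (injective_image_jostIdxP x) fun s => ∏ i ∈ s, w i)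
  congr 1 with q
  rw [Finset.prod_image fun a _ b _ hab => q.2.2.1.injective hab]

theorem tsum_finset_prod_ofReal_ne_top {w : ℤ → ℝ} (hw : ∀ i, 0 ≤ w i) (hs : Summable w) :
    ∑' s : Finset ℤ, ∏ i ∈ s, ENNReal.ofReal (w i) ≠ ∞ := by
  simp_rw [← ENNReal.ofReal_prod_of_nonneg fun i _ => hw i]
  exact (summable_finsetProd_of_summable_nonneg hw hs).tsum_ofReal_ne_top

theorem exists_measure_mPlus (α : ℤ → ℝ) (hα : Summable fun j : ℤ => |(j : ℝ)| * |α j|)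
    {x : ℝ} (hx : 0 ≤ x) :
    ∃ (μ : Measure ℝ) (f : ℝ → ℂ), IsFiniteMeasure μ ∧ (∀ ξ, ‖f ξ‖ = 1) ∧ Measurable f ∧
      μ (Set.Iio 0) = 0 ∧
      μ Set.univ ≤ ∑' s : Finset ℤ, ∏ i ∈ s, ENNReal.ofReal (|(i : ℝ)| * |α i|) ∧
      ∫⁻ ξ, ENNReal.ofReal ξ ∂μ ≤
        ∑' s : Finset ℤ, ∏ i ∈ s, ENNReal.ofReal ((1 + |(i : ℝ)|) * (|(i : ℝ)| * |α i|)) ∧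
      ∀ lam : ℝ, lam ≠ 0 → mPlus α lam x =
        1 + ∫ ξ : ℝ, Complex.exp (2 * Complex.I * lam * ξ) * f ξ ∂μ := by
  choose H hi hneg hnorm hmom hF using fun q : Σ n, jostIdxP x n =>
    exists_density_jostTermP α hx q.2.2.1 q.2.2.2
  have hle : ∑' q, ∫⁻ ξ, ‖H q ξ‖ₑ ≤
      ∑' s : Finset ℤ, ∏ i ∈ s, ENNReal.ofReal (|(i : ℝ)| * |α i|) :=
    (ENNReal.tsum_le_tsum hnorm).trans
      (tsum_prod_jostIdxP_le (fun i => ENNReal.ofReal (|(i : ℝ)| * |α i|)) x)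
  have hsum : ∑' q, ∫⁻ ξ, ‖H q ξ‖ₑ ≠ ∞ :=
    ne_top_of_le_ne_top (tsum_finset_prod_ofReal_ne_top (fun i => by positivity) hα) hle
  obtain ⟨μ, f, hfin, hf, hfm, h0, huniv, hξ, hint⟩ :=
    exists_polar_measure_of_tsum_lintegral_ne_top H (fun q => (hi q).aemeasurable) hneg hsum
  refine ⟨μ, f, hfin, hf, hfm, h0, huniv.trans hle, hξ.trans ((ENNReal.tsum_le_tsum hmom).trans
    (tsum_prod_jostIdxP_le
      (fun i => ENNReal.ofReal ((1 + |(i : ℝ)|) * (|(i : ℝ)| * |α i|))) x)), fun lam hlam => ?_⟩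
  have hexp : ∀ ξ : ℝ, ‖Complex.exp (2 * Complex.I * lam * ξ)‖ₑ = 1 := fun ξ => by
    rw [← ofReal_norm, norm_exp_two_I_mul, ENNReal.ofReal_one]
  have hsummable : Summable fun q : Σ n, jostIdxP x n => jostTermP α lam x q.2.1 := by
    refine Summable.of_enorm (ne_top_of_le_ne_top hsum (ENNReal.tsum_le_tsum fun q => ?_))
    rw [← hF q lam hlam]
    refine (enorm_integral_le_lintegral_enorm _).trans_eq ?_
    simp only [enorm_mul, hexp, one_mul]
  rw [mPlus, ← hint lam, ← hsummable.tsum_sigma]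
  congr 2 with q
  exact (hF q lam hlam).symm

/-- The reflection `j ↦ -j` turns the index set of `m_-` into that of `m_+`. -/
def jostIdxMEquiv (x : ℝ) (n : ℕ) : jostIdxM x n ≃ jostIdxP (-x) n where
  toFun j := ⟨fun l => -j.1 l, fun _ _ h => neg_lt_neg (j.2.1 h), by
    have := j.2.2
    push_cast
    linarith⟩
  invFun j := ⟨fun l => -j.1 l, fun _ _ h => neg_lt_neg (j.2.1 h), by
    have := j.2.2
    push_cast
    linarith⟩
  left_inv j := Subtype.ext (funext fun l => neg_neg _)
  right_inv j := Subtype.ext (funext fun l => neg_neg _)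

theorem mMinus_eq_mPlus (α : ℤ → ℝ) (lam : ℂ) (x : ℝ) :
    mMinus α lam x = mPlus (fun j => α (-j)) lam (-x) := by
  unfold mMinus mPlus
  congr 2 with n
  rw [← (jostIdxMEquiv x n).tsum_eq]
  congr 1 with j
  unfold jostTermM jostTermP
  refine Finset.prod_congr rfl fun l _ => ?_
  have hval : ∀ k, ((jostIdxMEquiv x n) j).1 k = -j.1 k := fun _ => rfl
  have hcons : (Fin.cons ((-x : ℝ) : ℂ)
      (fun k : Fin n => ((((jostIdxMEquiv x n) j).1 k.castSucc : ℤ) : ℂ)) : Fin (n + 1) → ℂ) l =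
      -(Fin.cons (x : ℂ) (fun k : Fin n => ((j.1 k.castSucc : ℤ) : ℂ)) : Fin (n + 1) → ℂ) l := by
    refine Fin.cases ?_ (fun k => ?_) l <;> simp [hval]
  rw [hcons, hval]
  beta_reduce
  rw [neg_neg]
  congr 4
  push_cast
  ring

/-- For `α ∈ ℓ^{1,1}(ℤ)`: for every `x ≥ 0` there is a finite complex Borel measure
(encoded by its polar decomposition: a finite positive measure `μ x` together with a
unimodular density `f x`, so that the total variation measure is `μ x` and the total
variation norm is `μ x univ`), supported in `[0,∞)`, with
`m_+(λ,x) = 1 + ∫ e^{2iλξ} f x ξ dμ x (ξ)` for all real `λ ≠ 0`, and with total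
variation norms uniformly bounded in `x ≥ 0`; likewise for `m_−` and `x ≤ 0`.
If moreover `α ∈ ℓ^{1,2}(ℤ)`, the first moments `∫ ξ d|μ_x|(ξ)` are also uniformly
bounded. -/
theorem statement18 (α : ℤ → ℝ) (hα : Summable fun j : ℤ => |(j : ℝ)| * |α j|) :
    ∃ (μ : ℝ → Measure ℝ) (f : ℝ → ℝ → ℂ) (ν : ℝ → Measure ℝ) (g : ℝ → ℝ → ℂ),
      (∀ x : ℝ, IsFiniteMeasure (μ x) ∧ IsFiniteMeasure (ν x)) ∧
      (∀ x : ℝ, ∀ ξ : ℝ, ‖f x ξ‖ = 1 ∧ ‖g x ξ‖ = 1) ∧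
      (∀ x : ℝ, Measurable (f x) ∧ Measurable (g x)) ∧
      (∃ C : ℝ≥0∞, C ≠ ∞ ∧ ∀ x : ℝ, 0 ≤ x →
        μ x (Set.Iio 0) = 0 ∧ μ x Set.univ ≤ C ∧
        ∀ lam : ℝ, lam ≠ 0 →
          mPlus α (lam : ℂ) x =
            1 + ∫ ξ : ℝ, Complex.exp (2 * Complex.I * (lam : ℂ) * (ξ : ℂ)) * f x ξ ∂(μ x)) ∧
      (∃ C : ℝ≥0∞, C ≠ ∞ ∧ ∀ x : ℝ, x ≤ 0 →
        ν x (Set.Iio 0) = 0 ∧ ν x Set.univ ≤ C ∧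
        ∀ lam : ℝ, lam ≠ 0 →
          mMinus α (lam : ℂ) x =
            1 + ∫ ξ : ℝ, Complex.exp (2 * Complex.I * (lam : ℂ) * (ξ : ℂ)) * g x ξ ∂(ν x)) ∧
      ((Summable fun j : ℤ => (j : ℝ) ^ 2 * |α j|) →
        (∃ C : ℝ≥0∞, C ≠ ∞ ∧ ∀ x : ℝ, 0 ≤ x →
          ∫⁻ ξ : ℝ, ENNReal.ofReal ξ ∂(μ x) ≤ C) ∧
        (∃ C : ℝ≥0∞, C ≠ ∞ ∧ ∀ x : ℝ, x ≤ 0 →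
          ∫⁻ ξ : ℝ, ENNReal.ofReal ξ ∂(ν x) ≤ C)) := by
  have hα' : Summable fun j : ℤ => |(j : ℝ)| * |α (-j)| := by
    simpa [Function.comp_def] using (Equiv.neg ℤ).summable_iff.2 hα
  have hP : ∀ (x : ℝ) (β : ℤ → ℝ), (Summable fun j : ℤ => |(j : ℝ)| * |β j|) → ∃ (μ : Measure ℝ)
      (f : ℝ → ℂ), IsFiniteMeasure μ ∧ (∀ ξ, ‖f ξ‖ = 1) ∧ Measurable f ∧ (0 ≤ x →
        μ (Set.Iio 0) = 0 ∧
        μ Set.univ ≤ ∑' s : Finset ℤ, ∏ i ∈ s, ENNReal.ofReal (|(i : ℝ)| * |β i|) ∧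
        ∫⁻ ξ, ENNReal.ofReal ξ ∂μ ≤
          ∑' s : Finset ℤ, ∏ i ∈ s, ENNReal.ofReal ((1 + |(i : ℝ)|) * (|(i : ℝ)| * |β i|)) ∧
        ∀ lam : ℝ, lam ≠ 0 → mPlus β lam x =
          1 + ∫ ξ : ℝ, Complex.exp (2 * Complex.I * lam * ξ) * f ξ ∂μ) := by
    intro x β hβ
    by_cases hx : 0 ≤ x
    · obtain ⟨μ, f, hfin, hf, hfm, h⟩ := exists_measure_mPlus β hβ hx
      exact ⟨μ, f, hfin, hf, hfm, fun _ => h⟩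
    · exact ⟨0, fun _ => 1, inferInstance, by simp, measurable_const, fun h => absurd h hx⟩
  choose μ f hμ hf hfm h using fun x => hP x α hα
  choose ν g hν hg hgm h' using fun x => hP (-x) (fun j => α (-j)) hα'
  refine ⟨μ, f, ν, g, fun x => ⟨hμ x, hν x⟩, fun x ξ => ⟨hf x ξ, hg x ξ⟩,
    fun x => ⟨hfm x, hgm x⟩,
    ⟨_, tsum_finset_prod_ofReal_ne_top (fun i => by positivity) hα, fun x hx => ?_⟩,
    ⟨_, tsum_finset_prod_ofReal_ne_top (fun i => by positivity) hα', fun x hx => ?_⟩,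
    fun hα₂ => ⟨⟨_, ?_, fun x hx => (h x hx).2.2.1⟩,
      ⟨_, ?_, fun x hx => (h' x (neg_nonneg.2 hx)).2.2.1⟩⟩⟩
  · obtain ⟨h0, hu, -, hF⟩ := h x hx
    exact ⟨h0, hu, hF⟩
  · obtain ⟨h0, hu, -, hF⟩ := h' x (neg_nonneg.2 hx)
    exact ⟨h0, hu, fun lam hlam => (mMinus_eq_mPlus α lam x).trans (hF lam hlam)⟩
  · refine tsum_finset_prod_ofReal_ne_top (fun i => by positivity) ((hα.add hα₂).congr fun j => ?_)
    rw [← sq_abs]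
    ring
  · have hα₂' : Summable fun j : ℤ => (j : ℝ) ^ 2 * |α (-j)| := by
      simpa [Function.comp_def] using (Equiv.neg ℤ).summable_iff.2 hα₂
    refine tsum_finset_prod_ofReal_ne_top (fun i => by positivity)
      ((hα'.add hα₂').congr fun j => ?_)
    rw [← sq_abs]
    ring
end

section
/- Let h : ℝ → ℂ be Lebesgue integrable with ∫_ℝ h(ξ) dξ = 0 and ∫_ℝ |ξ| |h(ξ)| dξ < ∞. Define G(ξ) := ∫_ξ^∞ h(η) dη. Then G is Lebesgue integrable on ℝ with ∫_ℝ |G(ξ)| dξ ≤ ∫_ℝ |ξ| |h(ξ)| dξ, and for every λ ∈ ℝ one has ∫_ℝ h(ξ) e^{iλξ} dξ = iλ ∫_ℝ G(ξ) e^{iλξ} dξ. -/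
open Complex MeasureTheory

/-- The signed indicator of the oriented interval from `0` to `η`, evaluated at `ξ`. -/
noncomputable def orientedIndicator (ξ η : ℝ) : ℂ :=
  (Set.Ici ξ).indicator 1 η - (Set.Iic 0).indicator 1 ξ

theorem measurable_orientedIndicator :
    Measurable fun p : ℝ × ℝ => orientedIndicator p.1 p.2 := by
  refine Measurable.sub ?_ ?_
  · exact (measurable_const (a := (1 : ℂ))).indicator
      (measurableSet_le measurable_fst measurable_snd)
  · exact (measurable_one.indicator measurableSet_Iic).comp measurable_fst

theorem orientedIndicator_eq (ξ η : ℝ) :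
    orientedIndicator ξ η = (Set.Ioc 0 η).indicator 1 ξ - (Set.Ioc η 0).indicator 1 ξ := by
  simp only [orientedIndicator, Set.indicator_apply, Set.mem_Ici, Set.mem_Iic, Set.mem_Ioc,
    Pi.one_apply]
  split_ifs <;> grind

theorem norm_orientedIndicator (ξ η : ℝ) :
    ‖orientedIndicator ξ η‖ = (Set.uIoc 0 η).indicator 1 ξ := by
  classical
  rw [Set.indicator_apply]
  simp only [orientedIndicator, Set.indicator_apply, Set.mem_Ici, Set.mem_Iic, Set.mem_uIoc,
    Pi.one_apply]
  split_ifs <;> first | grind | simp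

theorem integrable_norm_orientedIndicator (η : ℝ) :
    Integrable fun ξ => ‖orientedIndicator ξ η‖ := by
  simp only [norm_orientedIndicator]
  exact (integrable_indicator_iff measurableSet_uIoc).2 (integrableOn_const (by simp [Set.uIoc]))

theorem integral_norm_orientedIndicator (η : ℝ) : ∫ ξ, ‖orientedIndicator ξ η‖ = |η| := by
  simp only [norm_orientedIndicator]
  rw [integral_indicator_one measurableSet_uIoc]
  simp [Set.uIoc, Measure.real, max_sub_min_eq_abs]

theorem integral_orientedIndicator_mul {f : ℝ → ℂ} (hf : Continuous f) (η : ℝ) :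
    ∫ ξ, orientedIndicator ξ η * f ξ = ∫ ξ in (0 : ℝ)..η, f ξ := by
  have hint (a b : ℝ) : Integrable ((Set.Ioc a b).indicator f) :=
    (integrable_indicator_iff measurableSet_Ioc).2
      (hf.integrableOn_Icc.mono_set Set.Ioc_subset_Icc_self)
  rw [intervalIntegral, ← integral_indicator measurableSet_Ioc,
    ← integral_indicator measurableSet_Ioc, ← integral_sub (hint _ _) (hint _ _)]
  refine integral_congr_ae (.of_forall fun ξ => ?_)
  simp [orientedIndicator_eq, sub_mul, Set.indicator_apply]

theorem integral_Ioi_eq_integral_orientedIndicator_mul {h : ℝ → ℂ} (hInt : Integrable h)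
    (hZero : ∫ η, h η = 0) (ξ : ℝ) :
    ∫ η in Set.Ioi ξ, h η = ∫ η, orientedIndicator ξ η * h η := by
  simp only [orientedIndicator, sub_mul]
  rw [integral_sub _ (hInt.const_mul _), integral_const_mul, hZero, mul_zero, sub_zero,
    ← integral_Ici_eq_integral_Ioi, ← integral_indicator measurableSet_Ici]
  · simp [Set.indicator_apply]
  · refine (hInt.indicator (measurableSet_Ici (a := ξ))).congr (.of_forall fun η => ?_)
    simp [Set.indicator_apply]

theorem integrable_orientedIndicator_mul {h : ℝ → ℂ} (hInt : Integrable h)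
    (hMom : Integrable fun ξ : ℝ => |ξ| * ‖h ξ‖) :
    Integrable (fun p : ℝ × ℝ => orientedIndicator p.1 p.2 * h p.2) (volume.prod volume) := by
  have hmeas : AEStronglyMeasurable (fun p : ℝ × ℝ => orientedIndicator p.1 p.2 * h p.2)
      (volume.prod volume) :=
    measurable_orientedIndicator.aestronglyMeasurable.mul hInt.aestronglyMeasurable.comp_snd
  refine (integrable_prod_iff' hmeas).2 ⟨.of_forall fun η => ?_, ?_⟩
  · have hK : AEStronglyMeasurable fun ξ => orientedIndicator ξ η :=
      (measurable_orientedIndicator.comp measurable_prodMk_right).aestronglyMeasurable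
    exact ((integrable_norm_iff hK).1 (integrable_norm_orientedIndicator η)).mul_const (h η)
  · simpa only [norm_mul, integral_mul_const, integral_norm_orientedIndicator] using hMom

theorem mul_intervalIntegral_exp (c : ℂ) (η : ℝ) :
    c * ∫ ξ in (0 : ℝ)..η, Complex.exp (c * ξ) = Complex.exp (c * η) - 1 := by
  rcases eq_or_ne c 0 with rfl | hc
  · simp
  · rw [integral_exp_mul_complex hc]
    field_simp
    simp

/-- Let `h : ℝ → ℂ` be Lebesgue integrable with `∫ h = 0` and `∫ |ξ||h(ξ)| dξ < ∞`,
and set `G(ξ) = ∫_ξ^∞ h(η) dη`. Then `G` is integrable with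
`∫ |G| ≤ ∫ |ξ||h(ξ)| dξ`, and `∫ h(ξ) e^{iλξ} dξ = iλ ∫ G(ξ) e^{iλξ} dξ` for every
real `λ`. -/
theorem statement19 (h : ℝ → ℂ) (hInt : Integrable h)
    (hZero : (∫ ξ : ℝ, h ξ) = 0)
    (hMom : Integrable fun ξ : ℝ => |ξ| * ‖h ξ‖) :
    Integrable (fun ξ : ℝ => ∫ η in Set.Ioi ξ, h η) ∧
    (∫ ξ : ℝ, ‖∫ η in Set.Ioi ξ, h η‖) ≤ ∫ ξ : ℝ, |ξ| * ‖h ξ‖ ∧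
    ∀ lam : ℝ,
      (∫ ξ : ℝ, h ξ * Complex.exp (Complex.I * (lam : ℂ) * (ξ : ℂ))) =
        Complex.I * (lam : ℂ) *
          ∫ ξ : ℝ, (∫ η in Set.Ioi ξ, h η) * Complex.exp (Complex.I * (lam : ℂ) * (ξ : ℂ)) := by
  have hF := integrable_orientedIndicator_mul hInt hMom
  simp only [integral_Ioi_eq_integral_orientedIndicator_mul hInt hZero]
  refine ⟨hF.integral_prod_left, ?_, fun lam => ?_⟩
  · calc ∫ ξ, ‖∫ η, orientedIndicator ξ η * h η‖
        ≤ ∫ ξ, ∫ η, ‖orientedIndicator ξ η * h η‖ :=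
          integral_mono hF.integral_prod_left.norm hF.norm.integral_prod_left
            fun ξ => norm_integral_le_integral_norm _
      _ = ∫ η, ∫ ξ, ‖orientedIndicator ξ η * h η‖ := integral_integral_swap hF.norm
      _ = ∫ η, |η| * ‖h η‖ := by
          simp only [norm_mul, integral_mul_const, integral_norm_orientedIndicator]
  · set c : ℂ := Complex.I * lam with hc
    have hexp : Continuous fun ξ : ℝ => Complex.exp (c * ξ) := by fun_prop
    have hnorm (ξ : ℝ) : ‖Complex.exp (c * ξ)‖ = 1 := by
      simp [hc, Complex.norm_exp]
    have hFexp : Integrable (fun p : ℝ × ℝ =>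
        orientedIndicator p.1 p.2 * h p.2 * Complex.exp (c * p.1)) (volume.prod volume) :=
      hF.mul_bdd (c := 1) (hexp.comp continuous_fst).aestronglyMeasurable
        (.of_forall fun p => (hnorm p.1).le)
    have hhexp : Integrable fun ξ : ℝ => h ξ * Complex.exp (c * ξ) :=
      hInt.mul_bdd (c := 1) hexp.aestronglyMeasurable (.of_forall fun ξ => (hnorm ξ).le)
    symm
    calc c * ∫ ξ : ℝ, (∫ η, orientedIndicator ξ η * h η) * Complex.exp (c * ξ)
        = c * ∫ ξ : ℝ, ∫ η, orientedIndicator ξ η * h η * Complex.exp (c * ξ) := by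
          simp only [integral_mul_const]
      _ = c * ∫ η, ∫ ξ : ℝ, orientedIndicator ξ η * h η * Complex.exp (c * ξ) := by
          rw [integral_integral_swap hFexp]
      _ = ∫ η, (h η * Complex.exp (c * η) - h η) := by
          rw [← integral_const_mul]
          congr 1 with η
          simp only [mul_right_comm _ (h η), integral_mul_const]
          rw [integral_orientedIndicator_mul hexp, ← mul_assoc, mul_intervalIntegral_exp]
          ring
      _ = ∫ ξ : ℝ, h ξ * Complex.exp (c * ξ) := by
          rw [integral_sub hhexp hInt, hZero, sub_zero]
end
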